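/- Let g ≥ 2 be an integer and let F : ℝ^{n+2} → ℝ be an isoparametric polynomial of degree g, i.e. the evaluation of a homogeneous polynomial of degree g satisfying ‖∇F(x)‖² = g²·‖x‖^{2g−2} and ΔF(x) = c·‖x‖^{g−2} for all x, for some constant c ∈ ℝ, and let Φ := (1/g)·∇F. Let p ∈ S^{n+1}, set θ := arccos(F(p)), and assume θ ∈ (0, π) and sin((g−1)θ) ≠ 0. Then the (Fréchet) derivative of Φ at p maps the spherical gradient direction according to: DΦ_p(∇F(p) − g·F(p)·p) = (g−1)·(sin θ / sin((g−1)θ))·(∇F(Φ(p)) − g·F(Φ(p))·Φ(p)). (This is the statement that Φ sends the unit normal ξ̃ of the isoparametric hypersurface through p to (1−g) times the unit normal of the image hypersurface at Φ(p).) -/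

import Mathlib

open Real

/-- The Euclidean Laplacian of a function on a finite-dimensional real inner product space,
computed as the sum of second derivatives along an orthonormal basis. -/
noncomputable def laplacian {E : Type*} [NormedAddCommGroup E] [InnerProductSpace ℝ E]
    [FiniteDimensional ℝ E] (f : E → ℝ) (x : E) : ℝ :=
  ∑ i, iteratedFDeriv ℝ 2 f x ![stdOrthonormalBasis ℝ E i, stdOrthonormalBasis ℝ E i]

open scoped Topology RealInnerProductSpace ContDiff

/-- The great circle through `p` with initial velocity `ξ`. -/
noncomputable def greatCircle {E : Type*} [NormedAddCommGroup E] [InnerProductSpace ℝ E]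
    (p ξ : E) (t : ℝ) : E :=
  Real.cos t • p + Real.sin t • ξ

section GreatCircle

variable {E : Type*} [NormedAddCommGroup E] [InnerProductSpace ℝ E]

theorem hasDerivAt_greatCircle (p ξ : E) (t : ℝ) :
    HasDerivAt (greatCircle p ξ) (Real.cos t • ξ - Real.sin t • p) t := by
  have h := ((Real.hasDerivAt_cos t).smul_const p).add ((Real.hasDerivAt_sin t).smul_const ξ)
  exact h.congr_deriv (by module)

theorem greatCircle_add (p ξ : E) (s t : ℝ) :
    greatCircle p ξ (s + t) =
      Real.cos t • greatCircle p ξ s + Real.sin t • (Real.cos s • ξ - Real.sin s • p) := by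
  simp only [greatCircle, Real.cos_add, Real.sin_add]
  module

theorem contDiff_greatCircle {m : ℕ∞ω} (p ξ : E) : ContDiff ℝ m (greatCircle p ξ) :=
  (Real.contDiff_cos.smul contDiff_const).add (Real.contDiff_sin.smul contDiff_const)

theorem inner_greatCircle {p ξ : E} (hp : ‖p‖ = 1) (hξ : ‖ξ‖ = 1) (hpξ : ⟪p, ξ⟫ = 0)
    (s t : ℝ) : ⟪greatCircle p ξ s, greatCircle p ξ t⟫ = Real.cos (s - t) := by
  have hξp : ⟪ξ, p⟫ = 0 := by rw [real_inner_comm, hpξ]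
  simp only [greatCircle, inner_add_left, inner_add_right, real_inner_smul_left,
    real_inner_smul_right, real_inner_self_eq_norm_sq, hp, hξ, hpξ, hξp, Real.cos_sub]
  ring

theorem norm_greatCircle {p ξ : E} (hp : ‖p‖ = 1) (hξ : ‖ξ‖ = 1) (hpξ : ⟪p, ξ⟫ = 0)
    (t : ℝ) : ‖greatCircle p ξ t‖ = 1 := by
  have h := inner_greatCircle hp hξ hpξ t t
  rw [real_inner_self_eq_norm_sq, sub_self, Real.cos_zero] at h
  exact (pow_eq_one_iff_of_nonneg (norm_nonneg _) two_ne_zero).1 h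

/-- An analytic map `Φ`, homogeneous of degree `k` at the infinitesimal level and satisfying
`DΦ_x(Φ x) = k x` on the unit sphere, maps the great circle through `p` and `Φ p` to itself
by an affine map of the angle. -/
theorem map_greatCircle [CompleteSpace E] {Φ : E → E} (hA : ContDiff ℝ ω Φ) {k : ℝ}
    (hE : ∀ x, fderiv ℝ Φ x x = k • Φ x)
    (hS : ∀ x, ‖x‖ = 1 → fderiv ℝ Φ x (Φ x) = k • x)
    {p ξ : E} (hp : ‖p‖ = 1) (hξ : ‖ξ‖ = 1) (hpξ : ⟪p, ξ⟫ = 0)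
    {θ : ℝ} (hθ : Real.sin θ ≠ 0) (hΦ : Φ p = greatCircle p ξ θ) (t : ℝ) :
    Φ (greatCircle p ξ t) = greatCircle p ξ (θ - k * t) := by
  set γ := greatCircle p ξ with hγ
  set η : ℝ → E := fun t ↦ γ (θ - k * t) with hη
  have hγ' : ContDiff ℝ ω γ := contDiff_greatCircle p ξ
  have hη' : ContDiff ℝ ω η := hγ'.comp (contDiff_const.sub (contDiff_const.mul contDiff_id))
  suffices h : Φ ∘ γ =ᶠ[𝓝 0] η from
    congrFun (AnalyticOnNhd.eq_of_eventuallyEq (hA.comp hγ').analyticOnNhd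
      hη'.analyticOnNhd h) t
  set φ : ℝ → ℝ := fun t ↦ θ - (k + 1) * t with hφ
  have hφc : Continuous φ := by fun_prop
  set L : ℝ → E →L[ℝ] E := fun t ↦ (Real.sin (φ t))⁻¹ •
    (fderiv ℝ Φ (γ t) + (k * Real.cos (φ t)) • ContinuousLinearMap.id ℝ E) with hL
  set v : ℝ → E → E := fun t y ↦
    (Real.sin (φ t))⁻¹ • (fderiv ℝ Φ (γ t) (η t) + k • γ t) - L t y with hv
  have hne : ∀ᶠ t in 𝓝 0, Real.sin (φ t) ≠ 0 := by
    refine (Real.continuous_sin.comp hφc).continuousAt.eventually_ne ?_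
    simpa [hφ] using hθ
  have hLc : ContinuousAt L 0 := by
    have h0 : Real.sin (φ 0) ≠ 0 := by simpa [hφ] using hθ
    have h1 : Continuous fun t ↦ fderiv ℝ Φ (γ t) :=
      (hA.continuous_fderiv (by simp)).comp hγ'.continuous
    refine ContinuousAt.smul ((Real.continuous_sin.comp hφc).continuousAt.inv₀ h0) ?_
    fun_prop
  have hLip : ∀ᶠ t in 𝓝 (0 : ℝ), LipschitzOnWith (‖L 0‖₊ + 1) (v t) Set.univ := by
    filter_upwards [hLc.nnnorm.eventually_lt_const (lt_add_one ‖L 0‖₊)] with t ht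
    refine LipschitzWith.lipschitzOnWith (LipschitzWith.of_dist_le_mul fun x y ↦ ?_)
    rw [hv, dist_sub_left, dist_eq_norm, ← map_sub, dist_eq_norm]
    exact (L t).le_of_opNorm_le (by exact_mod_cast ht.le) _
  have hdγ : ∀ t, HasDerivAt γ (Real.cos t • ξ - Real.sin t • p) t := hasDerivAt_greatCircle p ξ
  have hγn : ∀ t, ‖γ t‖ = 1 := norm_greatCircle hp hξ hpξ
  have hγη : ∀ t, η t = Real.cos (φ t) • γ t +
      Real.sin (φ t) • (Real.cos t • ξ - Real.sin t • p) := fun t ↦ by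
    rw [← greatCircle_add]
    simp only [hη, hγ, hφ]
    ring_nf
  refine ODE_solution_unique_of_eventually hLip ?_ ?_ ?_
  · filter_upwards [hne] with t ht
    refine ⟨?_, Set.mem_univ _⟩
    have hd : HasDerivAt (Φ ∘ γ) (fderiv ℝ Φ (γ t) (Real.cos t • ξ - Real.sin t • p)) t :=
      (hA.differentiable (by simp) (γ t)).hasFDerivAt.comp_hasDerivAt t (hdγ t)
    refine hd.congr_deriv (Eq.symm ?_)
    have h1 := congrArg (fderiv ℝ Φ (γ t)) (hγη t)
    rw [map_add, map_smul, map_smul, hE] at h1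
    simp only [hv, hL, Function.comp_apply, h1, smul_apply, add_apply,
      ContinuousLinearMap.id_apply, hS _ (hγn t)]
    rw [← smul_sub, inv_smul_eq_iff₀ ht]
    module
  · filter_upwards [hne] with t ht
    refine ⟨?_, Set.mem_univ _⟩
    have hd := (hdγ (θ - k * t)).scomp t (((hasDerivAt_id t).const_mul k).const_sub θ)
    have h2 : γ t = Real.cos (φ t) • η t - Real.sin (φ t) •
        (Real.cos (θ - k * t) • ξ - Real.sin (θ - k * t) • p) := by
      have h : γ (θ - k * t + -φ t) = Real.cos (-φ t) • η t +
          Real.sin (-φ t) • (Real.cos (θ - k * t) • ξ - Real.sin (θ - k * t) • p) :=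
        greatCircle_add p ξ (θ - k * t) (-φ t)
      rw [Real.cos_neg, Real.sin_neg, neg_smul] at h
      rw [sub_eq_add_neg (Real.cos (φ t) • η t), ← h]
      congr 1
      simp only [hφ]
      ring
    refine (hd.congr_deriv (Eq.symm ?_) : HasDerivAt η _ t)
    simp only [hv, hL, smul_apply, add_apply,
      ContinuousLinearMap.id_apply]
    rw [← smul_sub, inv_smul_eq_iff₀ ht]
    nth_rw 2 [h2]
    module
  · have h0 : γ 0 = p := by simp [hγ, greatCircle]
    simp only [Function.comp_apply, hη, mul_zero, sub_zero, h0, hΦ]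

end GreatCircle

section Gradient

variable {E : Type*} [NormedAddCommGroup E] [InnerProductSpace ℝ E] [CompleteSpace E]

theorem ContDiff.gradient_omega {F : E → ℝ} (hF : ContDiff ℝ ω F) :
    ContDiff ℝ ω (gradient F) :=
  (InnerProductSpace.toDual ℝ E).symm.toContinuousLinearEquiv.contDiff.comp
    (hF.fderiv_right (m := ω) (by simp))

theorem inner_fderiv_gradient_comm {F : E → ℝ} (hF : ContDiff ℝ ω F) (x v w : E) :
    ⟪fderiv ℝ (gradient F) x v, w⟫ = ⟪fderiv ℝ (gradient F) x w, v⟫ := by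
  have hd : DifferentiableAt ℝ (gradient F) x := hF.gradient_omega.differentiable (by simp) x
  have hd' : DifferentiableAt ℝ (fderiv ℝ F) x :=
    (hF.fderiv_right (m := ω) (by simp)).differentiable (by simp) x
  have key : ∀ v w, ⟪fderiv ℝ (gradient F) x v, w⟫ = fderiv ℝ (fderiv ℝ F) x v w := by
    intro v w
    have h1 := hd.hasFDerivAt.inner ℝ (hasFDerivAt_const w x)
    have h2 := hd'.hasFDerivAt.clm_apply (hasFDerivAt_const w x)
    simp only [inner_gradient_left] at h1
    simpa [inner_gradient_left] using congrArg (· v) (h1.unique h2)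
  rw [key, key]
  exact hF.contDiffAt.isSymmSndFDerivAt (by simp) v w

theorem fderiv_gradient_self {F : E → ℝ} (hF : ContDiff ℝ ω F) {g : ℝ}
    (hE : ∀ x, ⟪gradient F x, x⟫ = g * F x) (x : E) :
    fderiv ℝ (gradient F) x x = (g - 1) • gradient F x := by
  refine ext_inner_right ℝ fun v ↦ ?_
  have h1 := (hF.gradient_omega.differentiable (by simp) x).hasFDerivAt.inner ℝ (hasFDerivAt_id x)
  have h2 := (hF.differentiable (by simp) x).hasFDerivAt.const_mul g
  simp only [id, hE] at h1
  have h := congrArg (· v) (h1.unique h2)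
  simp only [ContinuousLinearMap.comp_apply, smul_apply, smul_eq_mul,
    ContinuousLinearMap.prod_apply, fderivInnerCLM_apply, ContinuousLinearMap.id_apply,
    ← inner_gradient_left] at h
  rw [inner_fderiv_gradient_comm hF, real_inner_smul_left]
  linarith

theorem fderiv_gradient_gradient {F : E → ℝ} (hF : ContDiff ℝ ω F) {C : ℝ} {m : ℕ}
    (hN : ∀ x, ‖gradient F x‖ ^ 2 = C * (‖x‖ ^ 2) ^ m) {x : E} (hx : ‖x‖ = 1) :
    fderiv ℝ (gradient F) x (gradient F x) = (C * m) • x := by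
  refine ext_inner_right ℝ fun v ↦ ?_
  have h1 := (hF.gradient_omega.differentiable (by simp) x).hasFDerivAt.norm_sq
  have h2 := ((hasFDerivAt_id x).norm_sq.pow m).const_mul C
  simp only [hN, id] at h1 h2
  have h := congrArg (· v) (h1.unique h2)
  simp [hx, -inner_gradient_left] at h
  rw [inner_fderiv_gradient_comm hF, real_inner_smul_left, real_inner_comm]
  linarith

theorem inner_gradient_self_of_homogeneous {F : E → ℝ} (hF : Differentiable ℝ F) {g : ℕ}
    (h : ∀ (t : ℝ) x, F (t • x) = t ^ g * F x) (x : E) : ⟪gradient F x, x⟫ = g * F x := by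
  have h1 : HasDerivAt (fun t : ℝ ↦ F (t • x)) (fderiv ℝ F x x) 1 := by
    have hd := (hF ((1 : ℝ) • x)).hasFDerivAt.comp_hasDerivAt (1 : ℝ)
      ((hasDerivAt_id (1 : ℝ)).smul_const x)
    simpa [Function.comp_def] using hd
  have h2 : HasDerivAt (fun t : ℝ ↦ F (t • x)) (g * F x) 1 := by
    simp only [h]
    simpa using (hasDerivAt_pow g (1 : ℝ)).mul_const (F x)
  rw [inner_gradient_left, h1.unique h2]

end Gradient

theorem MvPolynomial.IsHomogeneous.eval_mul_left {σ R : Type*} [CommSemiring R]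
    {P : MvPolynomial σ R} {g : ℕ} (hP : P.IsHomogeneous g) (t : R) (x : σ → R) :
    MvPolynomial.eval (fun i ↦ t * x i) P = t ^ g * MvPolynomial.eval x P := by
  rw [MvPolynomial.eval_eq, MvPolynomial.eval_eq, Finset.mul_sum]
  refine Finset.sum_congr rfl fun d hd ↦ ?_
  have hdeg : ∑ i ∈ d.support, d i = g := by
    rw [← hP (MvPolynomial.mem_support_iff.1 hd)]
    simp [Finsupp.weight_apply, Finsupp.sum]
  simp only [mul_pow, Finset.prod_mul_distrib, Finset.prod_pow_eq_pow_sum, hdeg]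
  ring

/-- Let `F` be an isoparametric polynomial of degree `g ≥ 2` (a homogeneous
polynomial of degree `g` with `‖∇F(x)‖² = g² ‖x‖^{2g-2}` and `ΔF(x) = c ‖x‖^{g-2}`) and let
`Φ = (1/g) ∇F`.  Let `p` be on the unit sphere, `θ = arccos(F(p))`, and assume `θ ∈ (0, π)`
and `sin((g-1)θ) ≠ 0`.  Then the Fréchet derivative of `Φ` at `p` sends the spherical
gradient direction as
`DΦ_p(∇F(p) - g F(p) p) = (g-1)·(sin θ / sin((g-1)θ)) · (∇F(Φ(p)) - g F(Φ(p)) Φ(p))`,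
i.e. `Φ` sends the unit normal of the isoparametric hypersurface through `p` to `(1-g)`
times the unit normal of the image hypersurface at `Φ(p)`. -/
theorem gradientMap_fderiv_normal (n g : ℕ) (hg : 2 ≤ g)
    (F : EuclideanSpace ℝ (Fin (n + 2)) → ℝ)
    (P : MvPolynomial (Fin (n + 2)) ℝ) (hP : P.IsHomogeneous g)
    (hFP : ∀ x, F x = MvPolynomial.eval x P)
    (hCM1 : ∀ x, ‖gradient F x‖ ^ 2 = (g : ℝ) ^ 2 * ‖x‖ ^ (2 * g - 2))
    (c : ℝ) (hCM2 : ∀ x, laplacian F x = c * ‖x‖ ^ (g - 2))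
    (Φ : EuclideanSpace ℝ (Fin (n + 2)) → EuclideanSpace ℝ (Fin (n + 2)))
    (hΦ : ∀ x, Φ x = (g : ℝ)⁻¹ • gradient F x)
    (p : EuclideanSpace ℝ (Fin (n + 2))) (hp : ‖p‖ = 1)
    (θ : ℝ) (hθ : θ = Real.arccos (F p)) (hθ0 : 0 < θ) (hθπ : θ < π)
    (hsin : Real.sin (((g : ℝ) - 1) * θ) ≠ 0) :
    fderiv ℝ Φ p (gradient F p - ((g : ℝ) * F p) • p) =
      (((g : ℝ) - 1) * (Real.sin θ / Real.sin (((g : ℝ) - 1) * θ))) •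
        (gradient F (Φ p) - ((g : ℝ) * F (Φ p)) • Φ p) := by
  have hg0 : (g : ℝ) ≠ 0 := by positivity
  have hF : ContDiff ℝ ω F := by
    rw [show F = fun x ↦ MvPolynomial.eval x.ofLp P from funext hFP]
    exact (AnalyticOnNhd.eval_continuousLinearMap
      (EuclideanSpace.equiv (Fin (n + 2)) ℝ).toContinuousLinearMap P).contDiff
  have hEuler : ∀ x, ⟪gradient F x, x⟫ = g * F x :=
    inner_gradient_self_of_homogeneous (hF.differentiable (by simp)) fun t x ↦ by
      rw [hFP, hFP]
      exact hP.eval_mul_left t x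
  have hgrad : ∀ x, gradient F x = (g : ℝ) • Φ x := fun x ↦ by
    rw [hΦ, smul_inv_smul₀ hg0]
  have hfd : ∀ x, fderiv ℝ Φ x = (g : ℝ)⁻¹ • fderiv ℝ (gradient F) x := fun x ↦ by
    rw [show Φ = (g : ℝ)⁻¹ • gradient F from funext hΦ]
    exact fderiv_const_smul (hF.gradient_omega.differentiable (by simp) x) _
  have hΦω : ContDiff ℝ ω Φ := by
    rw [show Φ = fun x ↦ (g : ℝ)⁻¹ • gradient F x from funext hΦ]
    exact hF.gradient_omega.const_smul _
  have hΦE : ∀ x, fderiv ℝ Φ x x = ((g : ℝ) - 1) • Φ x := fun x ↦ by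
    rw [hfd, smul_apply, fderiv_gradient_self hF hEuler, smul_comm, ← hΦ]
  have hΦS : ∀ x, ‖x‖ = 1 → fderiv ℝ Φ x (Φ x) = ((g : ℝ) - 1) • x := fun x hx ↦ by
    have h := fderiv_gradient_gradient (C := (g : ℝ) ^ 2) (m := g - 1) hF (fun y ↦ by
      rw [hCM1, ← pow_mul, Nat.mul_sub, mul_one]) hx
    rw [hfd, smul_apply, hΦ, map_smul, h, Nat.cast_sub (by omega)]
    simp only [smul_smul]
    congr 1
    field_simp
    simp
  have hFΦ : ∀ x, F x = ⟪Φ x, x⟫ := fun x ↦ by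
    rw [hΦ, real_inner_smul_left, hEuler, inv_mul_cancel_left₀ hg0]
  have hΦn : ‖Φ p‖ = 1 := by
    have h := hCM1 p
    rw [hgrad, norm_smul, mul_pow, hp, one_pow, Real.norm_natCast] at h
    have h' : ‖Φ p‖ ^ 2 = 1 := mul_left_cancel₀ (pow_ne_zero 2 hg0) h
    exact (pow_eq_one_iff_of_nonneg (norm_nonneg _) two_ne_zero).1 h'
  have hcos : Real.cos θ = F p := by
    have h := abs_le.1 (abs_real_inner_le_norm (Φ p) p)
    rw [hΦn, hp, mul_one, ← hFΦ] at h
    rw [hθ, Real.cos_arccos h.1 h.2]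
  have hs : Real.sin θ ≠ 0 := (Real.sin_pos_of_pos_of_lt_pi hθ0 hθπ).ne'
  have hpp : ⟪p, p⟫ = 1 := by rw [real_inner_self_eq_norm_sq, hp, one_pow]
  have hΦΦ : ⟪Φ p, Φ p⟫ = 1 := by rw [real_inner_self_eq_norm_sq, hΦn, one_pow]
  have hΦp : ⟪Φ p, p⟫ = Real.cos θ := by rw [← hFΦ, hcos]
  have hpΦ : ⟪p, Φ p⟫ = Real.cos θ := by rw [real_inner_comm, hΦp]
  obtain ⟨ξ, hξ⟩ : ∃ ξ, ξ = (Real.sin θ)⁻¹ • (Φ p - Real.cos θ • p) := ⟨_, rfl⟩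
  have hpξ : ⟪p, ξ⟫ = 0 := by
    rw [hξ, real_inner_smul_right, inner_sub_right, real_inner_smul_right, hpp, hpΦ]
    ring
  have hξn : ‖ξ‖ = 1 := by
    have h : ⟪ξ, ξ⟫ = 1 := by
      simp only [hξ, real_inner_smul_right, real_inner_smul_left, inner_sub_right,
        inner_sub_left, hpp, hpΦ, hΦp, hΦΦ]
      field_simp
      linarith [Real.sin_sq_add_cos_sq θ]
    rw [real_inner_self_eq_norm_sq] at h
    exact (pow_eq_one_iff_of_nonneg (norm_nonneg _) two_ne_zero).1 h
  have hΦγ : Φ p = greatCircle p ξ θ := by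
    rw [greatCircle, hξ, smul_inv_smul₀ hs]
    module
  have hmap := map_greatCircle hΦω hΦE hΦS hp hξn hpξ hs hΦγ θ
  rw [← hΦγ] at hmap
  have hFΦΦ : F (Φ p) = Real.cos (((g : ℝ) - 1) * θ) := by
    rw [hFΦ, hmap, hΦγ, inner_greatCircle hp hξn hpξ, ← Real.cos_neg]
    ring_nf
  have hΦΦ' := greatCircle_add p ξ θ (-(((g : ℝ) - 1) * θ))
  rw [← sub_eq_add_neg, ← hmap, Real.cos_neg, Real.sin_neg, ← hΦγ] at hΦΦ'
  have hpθ := greatCircle_add p ξ θ (-θ)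
  rw [add_neg_cancel, Real.cos_neg, Real.sin_neg, ← hΦγ] at hpθ
  have hp0 : greatCircle p ξ 0 = p := by simp [greatCircle]
  rw [hp0] at hpθ
  rw [hgrad p, hgrad (Φ p), map_sub, map_smul, map_smul, hΦE, hΦS p hp, hFΦΦ, ← hcos, hΦΦ']
  have hL : p - Real.cos θ • Φ p = -Real.sin θ • (Real.cos θ • ξ - Real.sin θ • p) :=
    sub_eq_iff_eq_add'.2 hpθ
  calc
    _ = ((g : ℝ) * (g - 1)) • (p - Real.cos θ • Φ p) := by module
    _ = (((g : ℝ) - 1) * (Real.sin θ / Real.sin (((g : ℝ) - 1) * θ)) *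
          (-g * Real.sin (((g : ℝ) - 1) * θ))) •
          (Real.cos θ • ξ - Real.sin θ • p) := by
      rw [hL, smul_smul]
      congr 1
      field_simp
    _ = _ := by module
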